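/- The images of Φ and −Φ intersect, i.e. Φ([0, 2π]) ∩ (−Φ)([0, 2π]) ≠ ∅, if and only if λ = μ; and when λ = μ the intersection equals the two-element set {T, −T}. -/

import Mathlib

noncomputable section

open Real Set

/-- Membership predicate for conformally inscribed parallelograms.
Coordinates of `P : Fin 9 → ℝ`:
`0 = x_A, 1 = y_A, 2 = x_B, 3 = y_B, 4 = x_C, 5 = y_C, 6 = x_D, 7 = y_D, 8 = w`.
The vertex `(x_L, y_L)` lies on the line `L(w)` for `L ∈ {A,B,C,D}` and the
midpoints of the two diagonals coincide. -/
def IsCIP (mA mB mC mD bA : ℝ) (P : Fin 9 → ℝ) : Prop :=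
  P 1 = mA * P 0 + bA * P 8 ∧
  P 3 = mB * P 2 + P 8 ∧
  P 5 = mC * P 4 ∧
  P 7 = mD * P 6 ∧
  P 0 + P 4 = P 2 + P 6 ∧
  P 1 + P 5 = P 3 + P 7

/-- `Π`, the set of conformally inscribed parallelograms. -/
def CIP (mA mB mC mD bA : ℝ) : Set (Fin 9 → ℝ) := {P | IsCIP mA mB mC mD bA P}

/-- The `AC` diagonal vector of a parallelogram. -/
def vAC (P : Fin 9 → ℝ) : ℝ × ℝ := (P 0 - P 4, P 1 - P 5)

/-- The `BD` diagonal vector of a parallelogram. -/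
def vBD (P : Fin 9 → ℝ) : ℝ × ℝ := (P 2 - P 6, P 3 - P 7)

/-- The `AB` side vector of a parallelogram. -/
def vAB (P : Fin 9 → ℝ) : ℝ × ℝ := (P 0 - P 2, P 1 - P 3)

/-- The `BC` side vector of a parallelogram. -/
def vBC (P : Fin 9 → ℝ) : ℝ × ℝ := (P 2 - P 4, P 3 - P 5)

/-- Dot product in `ℝ²`. -/
def dot2 (a b : ℝ × ℝ) : ℝ := a.1 * b.1 + a.2 * b.2

/-- The inner product `⟨P, Q⟩ = P_AC · Q_AC + P_BD · Q_BD` on `Π`. -/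
def pinner (P Q : Fin 9 → ℝ) : ℝ := dot2 (vAC P) (vAC Q) + dot2 (vBD P) (vBD Q)

/-- The parametrization `Φ` of a conformal solution. -/
def Phi (U V T : Fin 9 → ℝ) (lam mu : ℝ) (θ : ℝ) : Fin 9 → ℝ :=
  (Real.sqrt (lam - mu * Real.cos θ ^ 2) / Real.sqrt (2 * lam)) • U +
    (Real.sin θ / Real.sqrt 2) • V + (Real.cos θ / Real.sqrt (2 * lam)) • T

theorem pinner_smul_add_smul_add_smul (U V T Q : Fin 9 → ℝ) (a b c : ℝ) :
    pinner (a • U + b • V + c • T) Q = a * pinner U Q + b * pinner V Q + c * pinner T Q := by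
  simp only [pinner, dot2, vAC, vBD, Pi.add_apply, Pi.smul_apply, smul_eq_mul]
  ring

theorem pinner_neg_left (P Q : Fin 9 → ℝ) : pinner (-P) Q = -pinner P Q := by
  simp only [pinner, dot2, vAC, vBD, Pi.neg_apply]
  ring

/-- The `U`-coordinate of `Φ θ`. -/
theorem pinner_Phi_left {U V T : Fin 9 → ℝ} (hUU : pinner U U = 1) (hVU : pinner V U = 0)
    (hTU : pinner T U = 0) (lam mu θ : ℝ) :
    pinner (Phi U V T lam mu θ) U =
      Real.sqrt (lam - mu * Real.cos θ ^ 2) / Real.sqrt (2 * lam) := by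
  rw [Phi, pinner_smul_add_smul_add_smul, hUU, hVU, hTU]
  ring

theorem pinner_comm (P Q : Fin 9 → ℝ) : pinner P Q = pinner Q P := by
  simp only [pinner, dot2]
  ring

/-- Where the images of `Φ` and `-Φ` meet, the `U`-coordinate vanishes. -/
theorem le_mu_mul_cos_sq_of_Phi_eq_neg {U V T : Fin 9 → ℝ} (hUU : pinner U U = 1)
    (hVU : pinner V U = 0) (hTU : pinner T U = 0) {lam mu θ φ : ℝ} (hlam : 0 < lam)
    (h : Phi U V T lam mu θ = -Phi U V T lam mu φ) : lam ≤ mu * Real.cos θ ^ 2 := by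
  have hc := congrArg (fun P => pinner P U) h
  simp only [pinner_neg_left, pinner_Phi_left hUU hVU hTU] at hc
  have h2 : 0 < Real.sqrt (2 * lam) := Real.sqrt_pos.2 (by linarith)
  have hθ : 0 ≤ Real.sqrt (lam - mu * Real.cos θ ^ 2) / Real.sqrt (2 * lam) := by positivity
  have hφ : 0 ≤ Real.sqrt (lam - mu * Real.cos φ ^ 2) / Real.sqrt (2 * lam) := by positivity
  have h0 : Real.sqrt (lam - mu * Real.cos θ ^ 2) / Real.sqrt (2 * lam) = 0 := by linarith
  have hs := (div_eq_zero_iff.1 h0).resolve_right h2.ne'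
  linarith [Real.sqrt_eq_zero'.1 hs]

theorem Phi_half_zero (U V T : Fin 9 → ℝ) : Phi U V T (1 / 2) (1 / 2) 0 = T := by
  simp [Phi]

theorem Phi_half_pi (U V T : Fin 9 → ℝ) : Phi U V T (1 / 2) (1 / 2) π = -T := by
  simp [Phi]

theorem Phi_half_of_cos_sq_eq_one (U V T : Fin 9 → ℝ) {θ : ℝ} (h : Real.cos θ ^ 2 = 1) :
    Phi U V T (1 / 2) (1 / 2) θ = T ∨ Phi U V T (1 / 2) (1 / 2) θ = -T := by
  have hs : Real.sin θ = 0 := by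
    have := Real.sin_sq_add_cos_sq θ
    exact pow_eq_zero_iff two_ne_zero |>.1 (by linarith)
  rcases eq_or_eq_neg_of_sq_eq_sq _ _ (h.trans (one_pow 2).symm) with hc | hc
  · left; simp [Phi, hs, hc]
  · right; simp [Phi, hs, hc]

theorem stmt_13 (mA mB mC mD bA : ℝ) (hCD : mC ≠ mD)
    (U V T : Fin 9 → ℝ)
    (hU : U ∈ CIP mA mB mC mD bA) (hV : V ∈ CIP mA mB mC mD bA)
    (hT : T ∈ CIP mA mB mC mD bA)
    (hUU : pinner U U = 1) (hVV : pinner V V = 1) (hTT : pinner T T = 1)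
    (hUV : pinner U V = 0) (hUT : pinner U T = 0) (hVT : pinner V T = 0)
    (hspan : ∀ P ∈ CIP mA mB mC mD bA, ∃ u v t : ℝ, P = u • U + v • V + t • T)
    (hUAC : vAC U = (0, 0)) (hVBD : vBD V = (0, 0))
    (lam mu : ℝ) (hlam : lam = dot2 (vAC T) (vAC T)) (hmu : mu = dot2 (vBD T) (vBD T))
    (hge : mu ≤ lam) :
    (Phi U V T lam mu '' Set.Icc 0 (2 * π) ∩
        (fun θ => -Phi U V T lam mu θ) '' Set.Icc 0 (2 * π) ≠ ∅ ↔ lam = mu) ∧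
    (lam = mu →
      Phi U V T lam mu '' Set.Icc 0 (2 * π) ∩
          (fun θ => -Phi U V T lam mu θ) '' Set.Icc 0 (2 * π) = {T, -T}) := by
  have hsum : lam + mu = 1 := by rw [hlam, hmu]; exact hTT
  have hpos : 0 < lam := by linarith
  have hmu0 : 0 ≤ mu := by
    rw [hmu, dot2]
    exact add_nonneg (mul_self_nonneg _) (mul_self_nonneg _)
  have hVU : pinner V U = 0 := by rw [pinner_comm, hUV]
  have hTU : pinner T U = 0 := by rw [pinner_comm, hUT]
  have hinter : lam = mu →
      Phi U V T lam mu '' Set.Icc 0 (2 * π) ∩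
          (fun θ => -Phi U V T lam mu θ) '' Set.Icc 0 (2 * π) = {T, -T} := by
    intro heq
    obtain rfl : lam = 1 / 2 := by linarith
    obtain rfl : mu = 1 / 2 := by linarith
    have h0 : (0 : ℝ) ∈ Set.Icc 0 (2 * π) := ⟨le_rfl, by positivity⟩
    have hpi : π ∈ Set.Icc 0 (2 * π) := ⟨Real.pi_pos.le, by linarith [Real.pi_pos]⟩
    apply Set.Subset.antisymm
    · rintro _ ⟨⟨θ, -, rfl⟩, φ, -, h⟩
      have hle := le_mu_mul_cos_sq_of_Phi_eq_neg hUU hVU hTU hpos h.symm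
      exact Phi_half_of_cos_sq_eq_one U V T
        (le_antisymm (Real.cos_sq_le_one θ) (by linarith))
    · rintro _ (rfl | rfl)
      · exact ⟨⟨0, h0, Phi_half_zero ..⟩, π, hpi, by simp only [Phi_half_pi, neg_neg]⟩
      · exact ⟨⟨π, hpi, Phi_half_pi ..⟩, 0, h0, by simp only [Phi_half_zero]⟩
  refine ⟨⟨fun hne => ?_, fun heq => ?_⟩, hinter⟩
  · obtain ⟨_, ⟨θ, -, rfl⟩, φ, -, h⟩ := Set.nonempty_iff_ne_empty.2 hne
    have hle := le_mu_mul_cos_sq_of_Phi_eq_neg hUU hVU hTU hpos h.symm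
    exact le_antisymm (hle.trans (mul_le_of_le_one_right hmu0 (Real.cos_sq_le_one θ))) hge
  · rw [hinter heq]
    exact (Set.insert_nonempty _ _).ne_empty
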